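/- arXiv:2605.07292 — 3 statements merged into one kernel-verified Lean document; each statement's English description precedes it below -/
import Mathlib

section
/- Let R > 0 and let r : ℝ → ℝ be twice continuously differentiable with r'(x) > 0 and r''(x) > 0 for all x > 0. Let I ⊆ ℝ be an interval and let x = (x₁, x₂) : I → ℝ² be differentiable with x₁(s) > 0, x₂(s) > 0, x₁'(s) > 0 and x₂'(s) > 0 for all s ∈ I, and suppose s ↦ R·(r(x₁(s)) − r(x₂(s))) is constant on I. Then the active promptness s ↦ ρ(x(s)) = R·√(r'(x₁(s))² + r'(x₂(s))²) is strictly increasing on I. -/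
/-- Along a constant-torque fiber of the VSA task map
`f(x₁,x₂) = R·(r(x₁) − r(x₂))`, internal co-contraction strictly increases the active
promptness `ρ(x₁,x₂) = R·√(r'(x₁)² + r'(x₂)²)`, assuming `r' > 0`, `r'' > 0`. -/
theorem stmt_2 (R : ℝ) (hR : 0 < R) (r : ℝ → ℝ) (hr : ContDiff ℝ 2 r)
    (hr' : ∀ x > 0, 0 < deriv r x) (hr'' : ∀ x > 0, 0 < deriv (deriv r) x)
    (I : Set ℝ) (hI : I.OrdConnected)
    (x₁ x₂ : ℝ → ℝ) (hx₁ : Differentiable ℝ x₁) (hx₂ : Differentiable ℝ x₂)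
    (hx₁pos : ∀ s ∈ I, 0 < x₁ s) (hx₂pos : ∀ s ∈ I, 0 < x₂ s)
    (hx₁' : ∀ s ∈ I, 0 < deriv x₁ s) (hx₂' : ∀ s ∈ I, 0 < deriv x₂ s)
    (hfiber : ∀ s ∈ I, ∀ t ∈ I,
      R * (r (x₁ s) - r (x₂ s)) = R * (r (x₁ t) - r (x₂ t))) :
    StrictMonoOn
      (fun s => R * Real.sqrt ((deriv r (x₁ s)) ^ 2 + (deriv r (x₂ s)) ^ 2)) I := by
  have hr_mono : StrictMonoOn (deriv r) (Set.Ioi 0) :=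
    strictMonoOn_of_deriv_pos (convex_Ioi 0) (hr.continuous_deriv (by norm_num)).continuousOn
      (by simpa using hr'')
  have deriv_comp_mono {x : ℝ → ℝ} (hx : Differentiable ℝ x) (hpos : ∀ s ∈ I, 0 < x s)
      (hx' : ∀ s ∈ I, 0 < deriv x s) : StrictMonoOn (fun s => deriv r (x s)) I :=
    hr_mono.comp
      (strictMonoOn_of_deriv_pos hI.convex hx.continuous.continuousOn
        fun s hs => hx' s (interior_subset hs))
      hpos
  intro s hs t ht hst
  have h₁ := deriv_comp_mono hx₁ hx₁pos hx₁' hs ht hst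
  have h₂ := deriv_comp_mono hx₂ hx₂pos hx₂' hs ht hst
  have p₁ := hr' _ (hx₁pos s hs)
  have p₂ := hr' _ (hx₂pos s hs)
  dsimp only at h₁ h₂ ⊢
  gcongr
end

section
/- Let R > 0 and let r : ℝ → ℝ be twice continuously differentiable with r'(x) > 0 and r''(x) > 0 for all x > 0. Let I ⊆ ℝ be an interval and let x = (x₁, x₂) : I → ℝ² be differentiable with x₁(s) > 0, x₂(s) > 0, x₁'(s) > 0 and x₂'(s) > 0 for all s ∈ I, and suppose s ↦ R·(r(x₁(s)) − r(x₂(s))) is constant on I. Then there exists a strictly increasing function g : ℝ → ℝ such that ρ(x(s)) = g(σ(x(s))) for all s ∈ I, where σ(x₁,x₂) = R²·(r'(x₁) + r'(x₂)) and ρ(x₁,x₂) = R·√(r'(x₁)² + r'(x₂)²). -/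
/-- A strictly monotone function on an order-connected set of reals, squeezed between two strictly
monotone functions, extends to a strictly monotone function on the whole line. -/
theorem StrictMonoOn.exists_strictMono_extension {S : Set ℝ} (hS : S.OrdConnected) {h A B : ℝ → ℝ}
    (hh : StrictMonoOn h S) (hA : StrictMono A) (hB : StrictMono B)
    (hAh : ∀ y ∈ S, A y ≤ h y) (hhB : ∀ y ∈ S, h y ≤ B y) :
    ∃ g : ℝ → ℝ, StrictMono g ∧ Set.EqOn g h S := by
  classical
  refine ⟨fun y => if y ∈ S then h y else if ∀ z ∈ S, y < z then A y else B y, ?_,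
    fun y hy => if_pos hy⟩
  have above : ∀ y ∉ S, (¬ ∀ z ∈ S, y < z) → ∃ z ∈ S, z < y := by
    intro y hy hb
    push Not at hb
    obtain ⟨z, hz, hzy⟩ := hb
    exact ⟨z, hz, lt_of_le_of_ne hzy fun e => hy (e ▸ hz)⟩
  intro a b hab
  dsimp only
  split_ifs with ha hb hb' ha' hb hb' hb hb'
  · exact hh ha hb hab
  · exact absurd (hb' a ha) hab.not_gt
  · exact (hhB a ha).trans_lt (hB hab)
  · exact (hA hab).trans_le (hAh b hb)
  · exact hA hab
  · obtain ⟨z, hz, hzb⟩ := above b hb hb'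
    exact ((hA (ha' z hz)).trans_le ((hAh z hz).trans (hhB z hz))).trans (hB hzb)
  · obtain ⟨z, hz, hza⟩ := above a ha ha'
    exact absurd (hS.out hz hb ⟨hza.le, hab.le⟩) ha
  · obtain ⟨z, hz, hza⟩ := above a ha ha'
    exact absurd (hb' z hz) (hza.trans hab).not_gt
  · exact hB hab

/-- A differentiable function with positive derivative on an order-connected set is strictly
monotone there. -/
theorem Set.OrdConnected.strictMonoOn_of_deriv_pos {f : ℝ → ℝ} {S : Set ℝ} (hS : S.OrdConnected)
    (hf : ContinuousOn f S) (hf' : ∀ x ∈ S, 0 < deriv f x) : StrictMonoOn f S :=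
  _root_.strictMonoOn_of_deriv_pos hS.convex hf fun x hx => hf' x (interior_subset hx)


/-- Along a connected co-contraction branch of a constant-torque fiber,
the promptness `ρ = R·√(r'(x₁)² + r'(x₂)²)` is a strictly increasing function of the
stiffness `σ = R²·(r'(x₁) + r'(x₂))`. -/
theorem stmt_3 (R : ℝ) (hR : 0 < R) (r : ℝ → ℝ) (hr : ContDiff ℝ 2 r)
    (hr' : ∀ x > 0, 0 < deriv r x) (hr'' : ∀ x > 0, 0 < deriv (deriv r) x)
    (I : Set ℝ) (hI : I.OrdConnected)
    (x₁ x₂ : ℝ → ℝ) (hx₁ : Differentiable ℝ x₁) (hx₂ : Differentiable ℝ x₂)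
    (hx₁pos : ∀ s ∈ I, 0 < x₁ s) (hx₂pos : ∀ s ∈ I, 0 < x₂ s)
    (hx₁' : ∀ s ∈ I, 0 < deriv x₁ s) (hx₂' : ∀ s ∈ I, 0 < deriv x₂ s)
    (hfiber : ∀ s ∈ I, ∀ t ∈ I,
      R * (r (x₁ s) - r (x₂ s)) = R * (r (x₁ t) - r (x₂ t))) :
    ∃ g : ℝ → ℝ, StrictMono g ∧ ∀ s ∈ I,
      R * Real.sqrt ((deriv r (x₁ s)) ^ 2 + (deriv r (x₂ s)) ^ 2)
        = g (R ^ 2 * (deriv r (x₁ s) + deriv r (x₂ s))) := by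
  have hd : Continuous (deriv r) := hr.continuous_deriv (by norm_num)
  have hmono : StrictMonoOn (deriv r) (Set.Ioi 0) :=
    Set.ordConnected_Ioi.strictMonoOn_of_deriv_pos hd.continuousOn hr''
  have hu : StrictMonoOn (fun s => deriv r (x₁ s)) I :=
    hmono.comp (hI.strictMonoOn_of_deriv_pos hx₁.continuous.continuousOn hx₁') hx₁pos
  have hv : StrictMonoOn (fun s => deriv r (x₂ s)) I :=
    hmono.comp (hI.strictMonoOn_of_deriv_pos hx₂.continuous.continuousOn hx₂') hx₂pos
  set σ : ℝ → ℝ := fun s => R ^ 2 * (deriv r (x₁ s) + deriv r (x₂ s)) with hσdef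
  set ρ : ℝ → ℝ := fun s => R * Real.sqrt ((deriv r (x₁ s)) ^ 2 + (deriv r (x₂ s)) ^ 2)
  have hσ : StrictMonoOn σ I := fun s hs t ht hst =>
    mul_lt_mul_of_pos_left (add_lt_add (hu hs ht hst) (hv hs ht hst)) (by positivity)
  have hρ : StrictMonoOn ρ I := fun s hs t ht hst =>
    mul_lt_mul_of_pos_left (Real.sqrt_lt_sqrt (by positivity) (add_lt_add
      (pow_lt_pow_left₀ (hu hs ht hst) (hr' _ (hx₁pos s hs)).le two_ne_zero)
      (pow_lt_pow_left₀ (hv hs ht hst) (hr' _ (hx₂pos s hs)).le two_ne_zero))) hR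
  have hσc : Continuous σ :=
    continuous_const.mul ((hd.comp hx₁.continuous).add (hd.comp hx₂.continuous))
  have hJ : (σ '' I).OrdConnected :=
    (hI.isPreconnected.image σ hσc.continuousOn).ordConnected
  have hinv : ∀ s ∈ I, Function.invFunOn σ I (σ s) = s := fun s hs =>
    hσ.injOn.leftInvOn_invFunOn hs
  have hρσ : ∀ s ∈ I, ρ s ≤ σ s / R := by
    intro s hs
    have h₁ := hr' _ (hx₁pos s hs)
    have h₂ := hr' _ (hx₂pos s hs)
    have hσR : σ s / R = R * (deriv r (x₁ s) + deriv r (x₂ s)) := by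
      simp only [hσdef]
      field_simp
    rw [hσR]
    refine mul_le_mul_of_nonneg_left (Real.sqrt_le_iff.2 ⟨by positivity, ?_⟩) hR.le
    nlinarith [mul_pos h₁ h₂]
  obtain ⟨g, hg, hgρ⟩ := StrictMonoOn.exists_strictMono_extension hJ
    (h := fun y => ρ (Function.invFunOn σ I y)) (A := fun y => -Real.exp (-y))
    (B := fun y => y / R)
    (by
      rintro _ ⟨s, hs, rfl⟩ _ ⟨t, ht, rfl⟩ hst
      simpa only [hinv s hs, hinv t ht] using hρ hs ht ((hσ.lt_iff_lt hs ht).1 hst))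
    (fun a b hab => neg_lt_neg (Real.exp_lt_exp.2 (neg_lt_neg hab)))
    (fun a b hab => div_lt_div_of_pos_right hab hR)
    (fun y _ => (neg_nonpos.2 (Real.exp_pos _).le).trans
      (mul_nonneg hR.le (Real.sqrt_nonneg _)))
    (by
      rintro _ ⟨s, hs, rfl⟩
      simpa only [hinv s hs] using hρσ s hs)
  refine ⟨g, hg, fun s hs => ?_⟩
  have := hgρ (Set.mem_image_of_mem σ hs)
  simp only [hinv s hs] at this
  exact this.symm
end

section
/- Let T : ℝ × ℝ → ℝ be twice continuously differentiable such that (∂T/∂v)(v, 0) > 0 and (∂λ/∂v)(v, 0) > 0 for all v > 0, where λ(v, ν) = −(∂T/∂ν)(v, ν). Let I ⊆ ℝ be an interval and let v = (v₁, v₂) : I → ℝ² be differentiable with v₁(s) > 0, v₂(s) > 0, v₁'(s) > 0 and v₂'(s) > 0 for all s ∈ I, and suppose s ↦ T(v₁(s), 0) − T(v₂(s), 0) is constant on I. Then the passive aerodynamic damping s ↦ σ_a(v(s)) = λ(v₁(s), 0) + λ(v₂(s), 0) is strictly increasing on I. -/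
/-- A function with positive derivative on a convex set is strictly increasing there;
continuity is automatic since a nonzero `deriv` forces differentiability. -/
theorem strictMonoOn_of_forall_deriv_pos {D : Set ℝ} (hD : Convex ℝ D) {f : ℝ → ℝ}
    (hf : ∀ x ∈ D, 0 < deriv f x) : StrictMonoOn f D :=
  strictMonoOn_of_deriv_pos hD
    (fun x hx => (differentiableAt_of_deriv_ne_zero (hf x hx).ne').continuousAt.continuousWithinAt)
    (fun x hx => hf x (interior_subset hx))

/-- Under monotone thrust `∂T/∂v(·,0) > 0` and aerodynamic hardening
`∂λ/∂v(·,0) > 0` (with `λ(v,ν) = −∂T/∂ν(v,ν)`), aerodynamic co-contraction along a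
constant-force fiber at zero inflow strictly increases the passive aerodynamic damping
`σ_a(v₁,v₂) = λ(v₁,0) + λ(v₂,0)`. -/
theorem stmt_7 (T : ℝ × ℝ → ℝ) (hT : ContDiff ℝ 2 T)
    (hTv : ∀ v > 0, 0 < deriv (fun w => T (w, 0)) v)
    (hhard : ∀ v > 0, 0 < deriv (fun w => -(deriv (fun y => T (w, y)) 0)) v)
    (I : Set ℝ) (hI : I.OrdConnected)
    (v₁ v₂ : ℝ → ℝ) (hv₁ : Differentiable ℝ v₁) (hv₂ : Differentiable ℝ v₂)
    (hv₁pos : ∀ s ∈ I, 0 < v₁ s) (hv₂pos : ∀ s ∈ I, 0 < v₂ s)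
    (hv₁' : ∀ s ∈ I, 0 < deriv v₁ s) (hv₂' : ∀ s ∈ I, 0 < deriv v₂ s)
    (hfiber : ∀ s ∈ I, ∀ t ∈ I,
      T (v₁ s, 0) - T (v₂ s, 0) = T (v₁ t, 0) - T (v₂ t, 0)) :
    StrictMonoOn
      (fun s => (-(deriv (fun y => T (v₁ s, y)) 0)) + (-(deriv (fun y => T (v₂ s, y)) 0)))
      I := by
  have hlam := strictMonoOn_of_forall_deriv_pos (convex_Ioi (0 : ℝ)) hhard
  have h₁ := strictMonoOn_of_forall_deriv_pos hI.convex hv₁'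
  have h₂ := strictMonoOn_of_forall_deriv_pos hI.convex hv₂'
  intro s hs t ht hst
  exact add_lt_add (hlam (hv₁pos s hs) (hv₁pos t ht) (h₁ hs ht hst))
    (hlam (hv₂pos s hs) (hv₂pos t ht) (h₂ hs ht hst))
end
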